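/- arXiv:2601.07174 — 2 statements merged into one kernel-verified Lean document; each statement's English description precedes it below -/
import Mathlib

section
/- Equivalence of the discrete elasticity bilinear form with a weighted quadratic form: for all λ, μ > 0 and every discrete tensor Z = (Z^{11}, Z^{22}, Z^{12}), setting Q(Z) = (1/μ)‖Z^{12}‖_T² + (1/(2λ+2μ))(‖Z^{11}‖_M² + ‖Z^{22}‖_M²), one has (μ/(λ+μ)) a_h(λ; Z, Z) ≤ Q(Z) ≤ a_h(λ; Z, Z). -/
open Finset

noncomputable section

/-- The midpoint `x_{i+1/2} = (x_i + x_{i+1})/2`. -/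
def midpt (x : ℕ → ℝ) (i : ℕ) : ℝ := (x i + x (i + 1)) / 2

/-- The cell width `h_{i+1/2} = x_{i+1} - x_i`. -/
def hMid (x : ℕ → ℝ) (i : ℕ) : ℝ := x (i + 1) - x i

/-- `h_i = x_{i+1/2} - x_{i-1/2}` for `1 ≤ i ≤ n-1`, together with the boundary
conventions `h_0 = h_{1/2}/2` and `h_n = h_{n-1/2}/2`. -/
def hNode (x : ℕ → ℝ) (n i : ℕ) : ℝ :=
  if i = 0 then hMid x 0 / 2
  else if i = n then hMid x (n - 1) / 2
  else midpt x i - midpt x (i - 1)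

/-- `0 = x_0 < x_1 < ⋯ < x_n = 1`. -/
def IsGrid (x : ℕ → ℝ) (n : ℕ) : Prop :=
  x 0 = 0 ∧ x n = 1 ∧ ∀ i < n, x i < x (i + 1)

/-- Discrete inner product `(φ,θ)_M` over the cell centers `(x_{i+1/2}, y_{j+1/2})`. -/
def ipM (x y : ℕ → ℝ) (nx ny : ℕ) (φ θ : ℕ → ℕ → ℝ) : ℝ :=
  ∑ i ∈ range nx, ∑ j ∈ range ny, hMid x i * hMid y j * φ i j * θ i j

/-- Discrete inner product `(φ,θ)_T` over the grid nodes `(x_i, y_j)`. -/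
def ipT (x y : ℕ → ℝ) (nx ny : ℕ) (φ θ : ℕ → ℕ → ℝ) : ℝ :=
  ∑ i ∈ range (nx + 1), ∑ j ∈ range (ny + 1), hNode x nx i * hNode y ny j * φ i j * θ i j

/-- Discrete inner product `(φ,θ)_{TM}` over the points `(x_i, y_{j+1/2})`,
`1 ≤ i ≤ n_x - 1`, `0 ≤ j ≤ n_y - 1`. -/
def ipTM (x y : ℕ → ℝ) (nx ny : ℕ) (φ θ : ℕ → ℕ → ℝ) : ℝ :=
  ∑ i ∈ Ico 1 nx, ∑ j ∈ range ny, hNode x nx i * hMid y j * φ i j * θ i j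

/-- Discrete inner product `(φ,θ)_{MT}` over the points `(x_{i+1/2}, y_j)`,
`0 ≤ i ≤ n_x - 1`, `1 ≤ j ≤ n_y - 1`. -/
def ipMT (x y : ℕ → ℝ) (nx ny : ℕ) (φ θ : ℕ → ℕ → ℝ) : ℝ :=
  ∑ i ∈ range nx, ∑ j ∈ Ico 1 ny, hMid x i * hNode y ny j * φ i j * θ i j

/-- The discrete elasticity bilinear form `a_h(λ; Z, τ)`. -/
def aForm (x y : ℕ → ℝ) (nx ny : ℕ) (lam mu : ℝ)
    (Z11 Z22 Z12 t11 t22 t12 : ℕ → ℕ → ℝ) : ℝ :=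
  (1 / mu) * ipT x y nx ny Z12 t12
    - (1 / (2 * mu)) * (lam / (2 * lam + 2 * mu)) *
        (ipM x y nx ny Z11 t22 + ipM x y nx ny Z22 t11)
    + (1 / (2 * mu)) * (1 - lam / (2 * lam + 2 * mu)) *
        (ipM x y nx ny Z11 t11 + ipM x y nx ny Z22 t22)

theorem IsGrid.hMid_nonneg {x : ℕ → ℝ} {n i : ℕ} (hx : IsGrid x n) (hi : i < n) :
    0 ≤ hMid x i :=
  sub_nonneg.2 (hx.2.2 i hi).le

theorem IsGrid.hNode_nonneg {x : ℕ → ℝ} {n i : ℕ} (hx : IsGrid x n) (hn : 0 < n) (hi : i ≤ n) :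
    0 ≤ hNode x n i := by
  unfold hNode
  split_ifs with h0 hin
  · exact div_nonneg (hx.hMid_nonneg hn) zero_le_two
  · exact div_nonneg (hx.hMid_nonneg (by omega)) zero_le_two
  · obtain ⟨k, rfl⟩ := Nat.exists_eq_succ_of_ne_zero h0
    have h1 := hx.2.2 k (by omega)
    have h2 := hx.2.2 (k + 1) (by omega)
    simp only [midpt, Nat.succ_eq_add_one, Nat.add_sub_cancel]
    linarith

theorem ipM_self_nonneg {x y : ℕ → ℝ} {nx ny : ℕ} (hx : IsGrid x nx) (hy : IsGrid y ny)
    (φ : ℕ → ℕ → ℝ) : 0 ≤ ipM x y nx ny φ φ := by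
  refine sum_nonneg fun i hi => sum_nonneg fun j hj => ?_
  rw [mul_assoc]
  exact mul_nonneg (mul_nonneg (hx.hMid_nonneg (mem_range.1 hi)) (hy.hMid_nonneg (mem_range.1 hj)))
    (mul_self_nonneg _)

theorem ipT_self_nonneg {x y : ℕ → ℝ} {nx ny : ℕ} (hx : IsGrid x nx) (hy : IsGrid y ny)
    (hnx : 0 < nx) (hny : 0 < ny) (φ : ℕ → ℕ → ℝ) : 0 ≤ ipT x y nx ny φ φ := by
  refine sum_nonneg fun i hi => sum_nonneg fun j hj => ?_
  rw [mul_assoc]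
  exact mul_nonneg (mul_nonneg (hx.hNode_nonneg hnx (mem_range_succ_iff.1 hi))
    (hy.hNode_nonneg hny (mem_range_succ_iff.1 hj))) (mul_self_nonneg _)

theorem ipM_add_self (x y : ℕ → ℝ) (nx ny : ℕ) (φ θ : ℕ → ℕ → ℝ) :
    ipM x y nx ny (φ + θ) (φ + θ) = ipM x y nx ny φ φ + ipM x y nx ny θ θ
      + (ipM x y nx ny φ θ + ipM x y nx ny θ φ) := by
  simp only [ipM, ← sum_add_distrib, Pi.add_apply]
  exact sum_congr rfl fun i _ => sum_congr rfl fun j _ => by ring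

theorem ipM_sub_self (x y : ℕ → ℝ) (nx ny : ℕ) (φ θ : ℕ → ℕ → ℝ) :
    ipM x y nx ny (φ - θ) (φ - θ) = ipM x y nx ny φ φ + ipM x y nx ny θ θ
      - (ipM x y nx ny φ θ + ipM x y nx ny θ φ) := by
  simp only [ipM, ← sum_add_distrib, ← sum_sub_distrib, Pi.sub_apply]
  exact sum_congr rfl fun i _ => sum_congr rfl fun j _ => by ring

/-- Equivalence of the discrete elasticity bilinear form with the weighted quadratic
form `Q(Z) = (1/μ)‖Z¹²‖_T² + (1/(2λ+2μ))(‖Z¹¹‖_M² + ‖Z²²‖_M²)`: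
`(μ/(λ+μ)) a_h(λ; Z, Z) ≤ Q(Z) ≤ a_h(λ; Z, Z)`. -/
theorem mac_aForm_equiv
    (nx ny : ℕ) (hnx : 2 ≤ nx) (hny : 2 ≤ ny)
    (x y : ℕ → ℝ) (hx : IsGrid x nx) (hy : IsGrid y ny)
    (lam mu : ℝ) (hlam : 0 < lam) (hmu : 0 < mu)
    (Z11 Z22 Z12 : ℕ → ℕ → ℝ) :
    (mu / (lam + mu)) * aForm x y nx ny lam mu Z11 Z22 Z12 Z11 Z22 Z12
        ≤ (1 / mu) * ipT x y nx ny Z12 Z12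
          + (1 / (2 * lam + 2 * mu)) * (ipM x y nx ny Z11 Z11 + ipM x y nx ny Z22 Z22) ∧
      (1 / mu) * ipT x y nx ny Z12 Z12
          + (1 / (2 * lam + 2 * mu)) * (ipM x y nx ny Z11 Z11 + ipM x y nx ny Z22 Z22)
        ≤ aForm x y nx ny lam mu Z11 Z22 Z12 Z11 Z22 Z12 := by
  have hadd := ipM_self_nonneg hx hy (Z11 + Z22)
  have hsub := ipM_self_nonneg hx hy (Z11 - Z22)
  have hT := ipT_self_nonneg hx hy (by omega) (by omega) Z12
  rw [ipM_add_self] at hadd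
  rw [ipM_sub_self] at hsub
  unfold aForm
  generalize ipM x y nx ny Z11 Z11 + ipM x y nx ny Z22 Z22 = S at *
  generalize ipM x y nx ny Z11 Z22 + ipM x y nx ny Z22 Z11 = C at *
  generalize ipT x y nx ny Z12 Z12 = T at *
  constructor <;> rw [← sub_nonneg]
  · have key : 0 ≤ lam / (mu * (lam + mu)) * T + lam / (4 * (lam + mu) ^ 2) * (S + C) := by
      positivity
    convert key using 1
    field_simp
    ring
  · have key : 0 ≤ lam / (4 * mu * (lam + mu)) * (S - C) := by
      positivity
    convert key using 1
    field_simp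
    ring
end
end

section
/- Second-order truncation estimate for the corrected cell-center interpolant of the normal stresses: let σ ∈ C³([0,1]²) and define σ̃ at the cell centers by σ̃_{i+1/2,j+1/2} = σ(x_{i+1/2}, y_{j+1/2}) − (h_{i+1/2}²/8)∂²_xσ(x_{i+1/2}, y_{j+1/2}) − (l_{j+1/2}²/8)∂²_yσ(x_{i+1/2}, y_{j+1/2}). Then there is a constant C, independent of the partitions and of σ, such that |∂_xσ(x_i, y_{j+1/2}) − [D_xσ̃]_{i,j+1/2}| ≤ C(h²+l²)‖σ‖_{3,∞} for all 1 ≤ i ≤ n_x−1, 0 ≤ j ≤ n_y−1, and |∂_yσ(x_{i+1/2}, y_j) − [D_yσ̃]_{i+1/2,j}| ≤ C(h²+l²)‖σ‖_{3,∞} for all 0 ≤ i ≤ n_x−1, 1 ≤ j ≤ n_y−1. -/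
open Finset

noncomputable section

/-- First partial derivative in `x`. -/
def pdx (f : ℝ × ℝ → ℝ) (p : ℝ × ℝ) : ℝ := deriv (fun t => f (t, p.2)) p.1

/-- First partial derivative in `y`. -/
def pdy (f : ℝ × ℝ → ℝ) (p : ℝ × ℝ) : ℝ := deriv (fun t => f (p.1, t)) p.2

/-- The norm `‖f‖_{3,∞}`: the sup over `[0,1]²` of the derivatives of `f` of order at
most `3`. -/
def norm3 (f : ℝ × ℝ → ℝ) : ℝ :=
  ⨆ p : Set.Icc ((0 : ℝ), (0 : ℝ)) ((1 : ℝ), (1 : ℝ)), ⨆ k : Fin 4,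
    ‖iteratedFDeriv ℝ (k : ℕ) f (p : ℝ × ℝ)‖

/-- The mesh size `h = max_i h_{i+1/2}`. -/
def hmax (x : ℕ → ℝ) (n : ℕ) : ℝ := ⨆ i : Fin n, hMid x i

/-- The corrected cell-center interpolant
`σ̃_{i+1/2,j+1/2} = σ - (h_{i+1/2}²/8)∂²ₓσ - (l_{j+1/2}²/8)∂²_yσ` at `(x_{i+1/2}, y_{j+1/2})`. -/
def sigmaTilde (x y : ℕ → ℝ) (σ : ℝ × ℝ → ℝ) (i j : ℕ) : ℝ :=
  σ (midpt x i, midpt y j)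
    - (hMid x i) ^ 2 / 8 * pdx (pdx σ) (midpt x i, midpt y j)
    - (hMid y j) ^ 2 / 8 * pdy (pdy σ) (midpt x i, midpt y j)

/-- Differentiating a partial derivative of `f` along a curve with velocity `v`. -/
theorem hasDerivAt_iteratedFDeriv_comp {E : Type*} [NormedAddCommGroup E] [NormedSpace ℝ E]
    {f : E → ℝ} {N : WithTop ℕ∞} (hf : ContDiff ℝ N f) {n : ℕ} (hn : (n : WithTop ℕ∞) < N)
    {c : ℝ → E} {v : E} {t : ℝ} (hc : HasDerivAt c v t) (m : Fin n → E) :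
    HasDerivAt (fun s => iteratedFDeriv ℝ n f (c s) m)
      (iteratedFDeriv ℝ (n + 1) f (c t) (Fin.cons v m)) t := by
  have h1 := ((hf.differentiable_iteratedFDeriv hn) (c t)).hasFDerivAt.comp_hasDerivAt t hc
  have h2 := (ContinuousMultilinearMap.apply ℝ (fun _ : Fin n => E) ℝ m).hasFDerivAt.comp_hasDerivAt
    t h1
  simpa [Function.comp_def, iteratedFDeriv_succ_apply_left] using h2

theorem pdx_eq_of_hasDerivAt {f : ℝ × ℝ → ℝ} {p : ℝ × ℝ} {a : ℝ}
    (h : HasDerivAt (fun t => f (t, p.2)) a p.1) : pdx f p = a := h.deriv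

theorem pdy_eq_of_hasDerivAt {f : ℝ × ℝ → ℝ} {p : ℝ × ℝ} {a : ℝ}
    (h : HasDerivAt (fun t => f (p.1, t)) a p.2) : pdy f p = a := h.deriv

theorem hasDerivAt_mk_left (b t : ℝ) : HasDerivAt (fun s : ℝ => (s, b)) ((1 : ℝ), (0 : ℝ)) t :=
  (hasDerivAt_id t).prodMk (hasDerivAt_const t b)

theorem hasDerivAt_mk_right (a t : ℝ) : HasDerivAt (fun s : ℝ => (a, s)) ((0 : ℝ), (1 : ℝ)) t :=
  (hasDerivAt_const t a).prodMk (hasDerivAt_id t)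

theorem pdx_iteratedFDeriv {f : ℝ × ℝ → ℝ} {N : WithTop ℕ∞} (hf : ContDiff ℝ N f) {n : ℕ}
    (hn : (n : WithTop ℕ∞) < N) (m : Fin n → ℝ × ℝ) :
    pdx (fun p => iteratedFDeriv ℝ n f p m) =
      fun p => iteratedFDeriv ℝ (n + 1) f p (Fin.cons (1, 0) m) :=
  funext fun p => pdx_eq_of_hasDerivAt
    (hasDerivAt_iteratedFDeriv_comp hf hn (hasDerivAt_mk_left p.2 p.1) m)

theorem pdy_iteratedFDeriv {f : ℝ × ℝ → ℝ} {N : WithTop ℕ∞} (hf : ContDiff ℝ N f) {n : ℕ}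
    (hn : (n : WithTop ℕ∞) < N) (m : Fin n → ℝ × ℝ) :
    pdy (fun p => iteratedFDeriv ℝ n f p m) =
      fun p => iteratedFDeriv ℝ (n + 1) f p (Fin.cons (0, 1) m) :=
  funext fun p => pdy_eq_of_hasDerivAt
    (hasDerivAt_iteratedFDeriv_comp hf hn (hasDerivAt_mk_right p.1 p.2) m)

theorem norm_iteratedFDeriv_le_norm3 {f : ℝ × ℝ → ℝ} (hf : ContDiff ℝ 3 f) (k : Fin 4)
    {p : ℝ × ℝ} (hp : p ∈ Set.Icc ((0 : ℝ), (0 : ℝ)) ((1 : ℝ), (1 : ℝ))) :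
    ‖iteratedFDeriv ℝ (k : ℕ) f p‖ ≤ norm3 f := by
  have hcont : ∀ k : Fin 4, Continuous fun p => ‖iteratedFDeriv ℝ (k : ℕ) f p‖ := fun k =>
    (hf.continuous_iteratedFDeriv (by exact_mod_cast Nat.le_of_lt_succ k.2)).norm
  have hsum : ContinuousOn (fun p => ∑ k : Fin 4, ‖iteratedFDeriv ℝ (k : ℕ) f p‖)
      (Set.Icc ((0 : ℝ), (0 : ℝ)) ((1 : ℝ), (1 : ℝ))) :=
    (continuous_finsetSum _ fun k _ => hcont k).continuousOn
  obtain ⟨B, hB⟩ := isCompact_Icc.bddAbove_image hsum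
  have hbdd : BddAbove (Set.range
      fun p : Set.Icc ((0 : ℝ), (0 : ℝ)) ((1 : ℝ), (1 : ℝ)) => ⨆ k : Fin 4,
        ‖iteratedFDeriv ℝ (k : ℕ) f (p : ℝ × ℝ)‖) := by
    refine ⟨B, ?_⟩
    rintro _ ⟨q, rfl⟩
    refine ciSup_le fun k => ?_
    exact (Finset.single_le_sum (f := fun k : Fin 4 => ‖iteratedFDeriv ℝ (k : ℕ) f (q : ℝ × ℝ)‖)
      (fun _ _ => norm_nonneg _) (mem_univ k)).trans (hB ⟨q, q.2, rfl⟩)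
  exact (le_ciSup (f := fun k : Fin 4 => ‖iteratedFDeriv ℝ (k : ℕ) f p‖)
    (Set.finite_range _).bddAbove k).trans (le_ciSup hbdd ⟨p, hp⟩)

theorem abs_iteratedFDeriv_three_le_norm3 {f : ℝ × ℝ → ℝ} (hf : ContDiff ℝ 3 f)
    {p : ℝ × ℝ} (hp : p ∈ Set.Icc ((0 : ℝ), (0 : ℝ)) ((1 : ℝ), (1 : ℝ)))
    {u v w : ℝ × ℝ} (hu : ‖u‖ ≤ 1) (hv : ‖v‖ ≤ 1) (hw : ‖w‖ ≤ 1) :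
    |iteratedFDeriv ℝ 3 f p (Fin.cons u (Fin.cons v (Fin.cons w ![])))| ≤ norm3 f := by
  have h := (iteratedFDeriv ℝ 3 f p).le_opNorm (Fin.cons u (Fin.cons v (Fin.cons w ![])))
  refine h.trans ((mul_le_of_le_one_right (norm_nonneg _) ?_).trans
    (norm_iteratedFDeriv_le_norm3 hf 3 hp))
  refine prod_le_one (fun _ _ => norm_nonneg _) fun i _ => ?_
  fin_cases i
  exacts [hu, hv, hw]

theorem abs_sub_le_of_hasDerivAt {f f' : ℝ → ℝ} (hf : ∀ t, HasDerivAt f (f' t) t) {a b M : ℝ}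
    (hM : ∀ t ∈ Set.uIcc a b, |f' t| ≤ M) : |f b - f a| ≤ M * |b - a| :=
  (convex_uIcc a b).norm_image_sub_le_of_norm_hasDerivWithin_le
    (fun t _ => (hf t).hasDerivWithinAt) hM Set.left_mem_uIcc Set.right_mem_uIcc

/-- Subtracting `(b - a)² / 2 * f₂ b` from `f b`, where `f₂` is the second derivative of `f`,
leaves the first-order Taylor polynomial of `f` at `a` up to third order. -/
theorem abs_corrected_taylor_le {f f₁ f₂ f₃ : ℝ → ℝ} (h₀ : ∀ t, HasDerivAt f (f₁ t) t)
    (h₁ : ∀ t, HasDerivAt f₁ (f₂ t) t) (h₂ : ∀ t, HasDerivAt f₂ (f₃ t) t) {a b M : ℝ}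
    (hM : ∀ t ∈ Set.uIcc a b, |f₃ t| ≤ M) :
    |f b - (b - a) ^ 2 / 2 * f₂ b - f a - (b - a) * f₁ a| ≤ 3 / 2 * M * |b - a| ^ 3 := by
  have hM0 : 0 ≤ M := (abs_nonneg _).trans (hM a Set.left_mem_uIcc)
  have hlip : ∀ t ∈ Set.uIcc a b,
      |f₁ t - f₁ a - (t - a) * f₂ t| ≤ M * |t - a| ^ 2 := by
    intro t ht
    have hsub : Set.uIcc a t ⊆ Set.uIcc a b := Set.uIcc_subset_uIcc_left ht
    have hd : ∀ s, HasDerivAt (fun s => f₁ s - s * f₂ t) (f₂ s - 1 * f₂ t) s := fun s =>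
      (h₁ s).sub ((hasDerivAt_id s).mul_const _)
    have := abs_sub_le_of_hasDerivAt (a := a) (b := t) (M := M * |t - a|) hd (by
      intro s hs
      rw [one_mul, abs_sub_comm]
      refine (abs_sub_le_of_hasDerivAt h₂ fun r hr => hM r (hsub ?_)).trans ?_
      · exact Set.uIcc_subset_uIcc_right hs hr
      · exact mul_le_mul_of_nonneg_left (Set.abs_sub_right_of_mem_uIcc hs) hM0)
    calc _ = |f₁ t - t * f₂ t - (f₁ a - a * f₂ t)| := by congr 1; ring
      _ ≤ _ := this.trans_eq (by ring)
  have hd : ∀ t, HasDerivAt (fun t => f t - (t - a) ^ 2 / 2 * f₂ t - (t - a) * f₁ a)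
      (f₁ t - f₁ a - (t - a) * f₂ t - (t - a) ^ 2 / 2 * f₃ t) t := by
    intro t
    have hs : HasDerivAt (fun t => t - a) 1 t := (hasDerivAt_id t).sub_const a
    refine (((h₀ t).sub (((hs.pow 2).div_const 2).mul (h₂ t))).sub
      (hs.mul_const (f₁ a))).congr_deriv ?_
    simp only [Pi.pow_apply]
    push_cast
    ring
  have := abs_sub_le_of_hasDerivAt (a := a) (b := b) (M := 3 / 2 * M * |b - a| ^ 2) hd (by
    intro t ht
    have hle : |t - a| ^ 2 ≤ |b - a| ^ 2 :=
      pow_le_pow_left₀ (abs_nonneg _) (Set.abs_sub_left_of_mem_uIcc ht) 2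
    have h3 : |(t - a) ^ 2 / 2 * f₃ t| ≤ |t - a| ^ 2 / 2 * M := by
      rw [abs_mul, abs_div, abs_pow, abs_two]
      exact mul_le_mul_of_nonneg_left (hM t ht) (by positivity)
    have := abs_sub (f₁ t - f₁ a - (t - a) * f₂ t) ((t - a) ^ 2 / 2 * f₃ t)
    have := hlip t ht
    nlinarith [mul_le_mul_of_nonneg_left hle hM0])
  calc _ = |f b - (b - a) ^ 2 / 2 * f₂ b - (b - a) * f₁ a
        - (f a - (a - a) ^ 2 / 2 * f₂ a - (a - a) * f₁ a)| := by congr 1; ring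
    _ ≤ _ := this.trans_eq (by ring)

theorem IsGrid.mem_Icc {x : ℕ → ℝ} {n : ℕ} (hx : IsGrid x n) {i : ℕ} (hi : i ≤ n) :
    x i ∈ Set.Icc (0 : ℝ) 1 := by
  obtain ⟨h0, h1, hlt⟩ := hx
  have hmono : MonotoneOn x (Set.Icc 0 n) :=
    monotoneOn_of_le_succ Set.ordConnected_Icc fun k _ _ hk => (hlt k hk.2).le
  refine ⟨h0 ▸ hmono ?_ ?_ (Nat.zero_le i), h1 ▸ hmono ?_ ?_ hi⟩ <;> simp [hi]

theorem IsGrid.midpt_mem_Icc {x : ℕ → ℝ} {n : ℕ} (hx : IsGrid x n) {i : ℕ} (hi : i < n) :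
    midpt x i ∈ Set.Icc (0 : ℝ) 1 := by
  have ha := hx.mem_Icc hi.le
  have hb := hx.mem_Icc (Nat.succ_le_of_lt hi)
  simp only [midpt, Set.mem_Icc, Nat.succ_eq_add_one] at *
  constructor <;> linarith

theorem IsGrid.hMid_pos {x : ℕ → ℝ} {n : ℕ} (hx : IsGrid x n) {i : ℕ} (hi : i < n) :
    0 < hMid x i := sub_pos.2 (hx.2.2 i hi)

theorem hMid_le_hmax (x : ℕ → ℝ) {n i : ℕ} (hi : i < n) : hMid x i ≤ hmax x n :=
  le_ciSup (f := fun i : Fin n => hMid x i) (Set.finite_range _).bddAbove ⟨i, hi⟩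

/-- One-dimensional truncation estimate, with an additional correction `l² / 8 * g`
coming from the transverse direction. -/
theorem IsGrid.abs_deriv_sub_corrected_difference_le {x : ℕ → ℝ} {n : ℕ} (hx : IsGrid x n)
    {f f₁ f₂ f₃ g g₁ : ℝ → ℝ} (h₀ : ∀ t, HasDerivAt f (f₁ t) t)
    (h₁ : ∀ t, HasDerivAt f₁ (f₂ t) t) (h₂ : ∀ t, HasDerivAt f₂ (f₃ t) t)
    (hg : ∀ t, HasDerivAt g (g₁ t) t) {M : ℝ} (hfM : ∀ t ∈ Set.Icc (0 : ℝ) 1, |f₃ t| ≤ M)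
    (hgM : ∀ t ∈ Set.Icc (0 : ℝ) 1, |g₁ t| ≤ M) {l L : ℝ} (hl : 0 ≤ l) (hlL : l ≤ L)
    {i : ℕ} (hi : 1 ≤ i) (hin : i < n) :
    |f₁ (x i) - ((f (midpt x i) - hMid x i ^ 2 / 8 * f₂ (midpt x i) - l ^ 2 / 8 * g (midpt x i))
        - (f (midpt x (i - 1)) - hMid x (i - 1) ^ 2 / 8 * f₂ (midpt x (i - 1))
          - l ^ 2 / 8 * g (midpt x (i - 1)))) / hNode x n i|
      ≤ (hmax x n ^ 2 + L ^ 2) * M := by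
  obtain ⟨k, rfl⟩ : ∃ k, i = k + 1 := ⟨i - 1, by omega⟩
  have hkn : k < n := by omega
  have hM0 : 0 ≤ M := (abs_nonneg _).trans (hfM 0 (by simp))
  have hnode : hNode x n (k + 1) = midpt x (k + 1) - midpt x k := by
    simp [hNode, hin.ne]
  rw [hnode, Nat.add_sub_cancel]
  have hsub : ∀ {s t : ℝ}, s ∈ Set.Icc (0 : ℝ) 1 → t ∈ Set.Icc (0 : ℝ) 1 →
      Set.uIcc s t ⊆ Set.Icc 0 1 := fun hs ht => Set.ordConnected_Icc.uIcc_subset hs ht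
  have hm1 := hx.midpt_mem_Icc hin
  have hm0 := hx.midpt_mem_Icc hkn
  have hxi := hx.mem_Icc hin.le
  have T1 := abs_corrected_taylor_le h₀ h₁ h₂ (fun t ht => hfM t (hsub hxi hm1 ht))
  have T0 := abs_corrected_taylor_le h₀ h₁ h₂ (fun t ht => hfM t (hsub hxi hm0 ht))
  have G := abs_sub_le_of_hasDerivAt hg (fun t ht => hgM t (hsub hm0 hm1 ht))
  have hb := hx.hMid_pos hin
  have ha := hx.hMid_pos hkn
  have hbH := hMid_le_hmax x hin
  have haH := hMid_le_hmax x hkn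
  have e1 : midpt x (k + 1) - x (k + 1) = hMid x (k + 1) / 2 := by simp only [midpt, hMid]; ring
  have e0 : midpt x k - x (k + 1) = -(hMid x k / 2) := by simp only [midpt, hMid]; ring
  have ed : midpt x (k + 1) - midpt x k = (hMid x k + hMid x (k + 1)) / 2 := by linarith
  rw [e1, abs_of_pos (by positivity : 0 < hMid x (k + 1) / 2)] at T1
  rw [e0, abs_neg, abs_of_pos (by positivity : 0 < hMid x k / 2)] at T0
  rw [ed, abs_of_pos (by positivity : 0 < (hMid x k + hMid x (k + 1)) / 2)] at G
  rw [ed]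
  generalize hMid x (k + 1) = b at *
  generalize hMid x k = a at *
  generalize hmax x n = H at *
  generalize midpt x (k + 1) = m₁ at *
  generalize midpt x k = m₀ at *
  generalize x (k + 1) = c at *
  have hpos : 0 < (a + b) / 2 := by positivity
  rw [sub_div' hpos.ne', abs_div, abs_of_pos hpos, div_le_iff₀ hpos]
  have hl2 : l ^ 2 ≤ L ^ 2 := pow_le_pow_left₀ hl hlL 2
  have hG : |l ^ 2 / 8 * (g m₁ - g m₀)| ≤ L ^ 2 * M * ((a + b) / 2) := by
    rw [abs_mul, abs_of_nonneg (by positivity)]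
    calc _ ≤ L ^ 2 * (M * ((a + b) / 2)) := by
          gcongr
          nlinarith [sq_nonneg l]
      _ = _ := by ring
  have ha3 : a ^ 3 ≤ H ^ 2 * a := by
    rw [pow_succ]; gcongr
  have hb3 : b ^ 3 ≤ H ^ 2 * b := by
    rw [pow_succ]; gcongr
  have hcube : 3 / 2 * M * (b / 2) ^ 3 + 3 / 2 * M * (a / 2) ^ 3 ≤ H ^ 2 * M * ((a + b) / 2) := by
    have := mul_le_mul_of_nonneg_left (add_le_add ha3 hb3) hM0
    have : 0 ≤ M * (H ^ 2 * a + H ^ 2 * b) := by positivity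
    nlinarith
  calc _ = |(f m₀ - (-(a / 2)) ^ 2 / 2 * f₂ m₀ - f c - -(a / 2) * f₁ c)
        - (f m₁ - (b / 2) ^ 2 / 2 * f₂ m₁ - f c - b / 2 * f₁ c)
        + l ^ 2 / 8 * (g m₁ - g m₀)| := by congr 1; ring
    _ ≤ 3 / 2 * M * (a / 2) ^ 3 + 3 / 2 * M * (b / 2) ^ 3 + L ^ 2 * M * ((a + b) / 2) :=
      (abs_add_le _ _).trans (add_le_add ((abs_sub _ _).trans (add_le_add T0 T1)) hG)
    _ ≤ _ := by linarith

/-- Second-order truncation estimate for the corrected cell-center interpolant of the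
normal stresses: `|∂ₓσ(x_i, y_{j+1/2}) - [D_x σ̃]_{i,j+1/2}| ≤ C(h²+l²)‖σ‖_{3,∞}` at
interior vertical edges, and the analogous estimate in the `y`-direction. -/
theorem mac_stress_interpolant_truncation :
    ∃ C > (0 : ℝ), ∀ (nx ny : ℕ), 2 ≤ nx → 2 ≤ ny → ∀ (x y : ℕ → ℝ),
      IsGrid x nx → IsGrid y ny → ∀ σ : ℝ × ℝ → ℝ, ContDiff ℝ 3 σ →
      (∀ i, 1 ≤ i → i < nx → ∀ j < ny,
        |pdx σ (x i, midpt y j)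
            - (sigmaTilde x y σ i j - sigmaTilde x y σ (i - 1) j) / hNode x nx i|
          ≤ C * ((hmax x nx) ^ 2 + (hmax y ny) ^ 2) * norm3 σ) ∧
      (∀ i < nx, ∀ j, 1 ≤ j → j < ny →
        |pdy σ (midpt x i, y j)
            - (sigmaTilde x y σ i j - sigmaTilde x y σ i (j - 1)) / hNode y ny j|
          ≤ C * ((hmax x nx) ^ 2 + (hmax y ny) ^ 2) * norm3 σ) := by
  refine ⟨1, one_pos, fun nx ny _ _ x y hx hy σ hσ => ?_⟩
  have e0 : σ = fun p => iteratedFDeriv ℝ 0 σ p ![] := by ext p; simp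
  have hx1 : pdx σ = fun p => iteratedFDeriv ℝ 1 σ p (Fin.cons (1, 0) ![]) := by
    conv_lhs => rw [e0]
    exact pdx_iteratedFDeriv hσ (by norm_num) _
  have hy1 : pdy σ = fun p => iteratedFDeriv ℝ 1 σ p (Fin.cons (0, 1) ![]) := by
    conv_lhs => rw [e0]
    exact pdy_iteratedFDeriv hσ (by norm_num) _
  have hx2 : pdx (pdx σ) = fun p =>
      iteratedFDeriv ℝ 2 σ p (Fin.cons (1, 0) (Fin.cons (1, 0) ![])) := by
    rw [hx1]; exact pdx_iteratedFDeriv hσ (by norm_num) _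
  have hy2 : pdy (pdy σ) = fun p =>
      iteratedFDeriv ℝ 2 σ p (Fin.cons (0, 1) (Fin.cons (0, 1) ![])) := by
    rw [hy1]; exact pdy_iteratedFDeriv hσ (by norm_num) _
  constructor
  · intro i hi hin j hj
    have hY := hy.midpt_mem_Icc hj
    have hc := hasDerivAt_mk_left (midpt y j)
    have hmem : ∀ t ∈ Set.Icc (0 : ℝ) 1,
        (t, midpt y j) ∈ Set.Icc ((0 : ℝ), (0 : ℝ)) ((1 : ℝ), (1 : ℝ)) :=
      fun t ht => ⟨⟨ht.1, hY.1⟩, ⟨ht.2, hY.2⟩⟩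
    have key := hx.abs_deriv_sub_corrected_difference_le
      (fun t => hasDerivAt_iteratedFDeriv_comp hσ (n := 0) (by norm_num) (hc t) ![])
      (fun t => hasDerivAt_iteratedFDeriv_comp hσ (n := 1) (by norm_num) (hc t) _)
      (fun t => hasDerivAt_iteratedFDeriv_comp hσ (n := 2) (by norm_num) (hc t) _)
      (fun t => hasDerivAt_iteratedFDeriv_comp hσ (n := 2) (by norm_num) (hc t)
        (Fin.cons (0, 1) (Fin.cons (0, 1) ![])))
      (fun t ht => abs_iteratedFDeriv_three_le_norm3 hσ (hmem t ht)
        (by simp) (by simp) (by simp))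
      (fun t ht => abs_iteratedFDeriv_three_le_norm3 hσ (hmem t ht)
        (by simp) (by simp) (by simp))
      (hy.hMid_pos hj).le (hMid_le_hmax y hj) hi hin
    simp only [iteratedFDeriv_zero_apply] at key
    simp only [sigmaTilde, hx2, hy2, one_mul]
    rw [hx1]
    exact key
  · intro i hin j hj hjn
    have hX := hx.midpt_mem_Icc hin
    have hc := hasDerivAt_mk_right (midpt x i)
    have hmem : ∀ t ∈ Set.Icc (0 : ℝ) 1,
        (midpt x i, t) ∈ Set.Icc ((0 : ℝ), (0 : ℝ)) ((1 : ℝ), (1 : ℝ)) :=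
      fun t ht => ⟨⟨hX.1, ht.1⟩, ⟨hX.2, ht.2⟩⟩
    have key := hy.abs_deriv_sub_corrected_difference_le
      (fun t => hasDerivAt_iteratedFDeriv_comp hσ (n := 0) (by norm_num) (hc t) ![])
      (fun t => hasDerivAt_iteratedFDeriv_comp hσ (n := 1) (by norm_num) (hc t) _)
      (fun t => hasDerivAt_iteratedFDeriv_comp hσ (n := 2) (by norm_num) (hc t) _)
      (fun t => hasDerivAt_iteratedFDeriv_comp hσ (n := 2) (by norm_num) (hc t)
        (Fin.cons (1, 0) (Fin.cons (1, 0) ![])))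
      (fun t ht => abs_iteratedFDeriv_three_le_norm3 hσ (hmem t ht)
        (by simp) (by simp) (by simp))
      (fun t ht => abs_iteratedFDeriv_three_le_norm3 hσ (hmem t ht)
        (by simp) (by simp) (by simp))
      (hx.hMid_pos hin).le (hMid_le_hmax x hin) hj hjn
    simp only [iteratedFDeriv_zero_apply] at key
    simp only [sigmaTilde, hx2, hy2, one_mul]
    rw [hy1, add_comm (hmax x nx ^ 2), sub_right_comm (σ (midpt x i, midpt y j)),
      sub_right_comm (σ (midpt x i, midpt y (j - 1)))]
    exact key
end
end
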